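/- arXiv:1612.05182 — 2 statements merged into one kernel-verified Lean document; each statement's English description precedes it below -/
import Mathlib

section
/- The family of linear maps (T_P), indexed by ALL set partitions P of Fin k ⊕ Fin ℓ, is linearly independent in the space of linear maps W_k → W_ℓ if and only if k + ℓ ≤ n. (This is the concrete content of part (2) of the theorem on the kernel of Φ: the map Φ : Hom_{P(n)}(k,ℓ) → Hom_{S_n}(V^{⊗k}, V^{⊗ℓ}) is an isomorphism if and only if k + ℓ ≤ n.) -/
open scoped Classical

noncomputable section

namespace Jellyfish

variable {𝕜 : Type*} [Field 𝕜]

/-- The indicator (delta) function `δ_i` of a tuple `i`, a basis vector of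
`W = (ι → Fin n) → 𝕜`. -/
def delta {ι : Type*} {n : ℕ} (i : ι → Fin n) : (ι → Fin n) → 𝕜 :=
  fun j => if j = i then 1 else 0

/-- The linear action of `Equiv.Perm (Fin n)` on `(ι → Fin n) → 𝕜`; it satisfies
`permAct σ (delta i) = delta (σ ∘ i)`. -/
def permAct {ι : Type*} {n : ℕ} (σ : Equiv.Perm (Fin n)) (g : (ι → Fin n) → 𝕜) :
    (ι → Fin n) → 𝕜 :=
  fun j => g (⇑σ.symm ∘ j)

/-- `DET i`: the determinant of the `n × n` matrix whose `b`-th column is the standard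
basis vector `e_{i b}`; entry `(a,b)` is `1` if `i b = a` and `0` otherwise. -/
def DET {n : ℕ} (i : Fin n → Fin n) : 𝕜 :=
  Matrix.det (Matrix.of fun a b => if i b = a then (1 : 𝕜) else 0)

/-- `a` and `b` lie in a common block of the set partition `P`. -/
def sameBlock {ι : Type*} [DecidableEq ι] [Fintype ι]
    (P : Finpartition (Finset.univ : Finset ι)) (a b : ι) : Prop :=
  ∃ B ∈ P.parts, a ∈ B ∧ b ∈ B

/-- The tuple `i` is constant on every block of the set partition `P`. -/
def constOnBlocks {ι : Type*} [DecidableEq ι] [Fintype ι] {n : ℕ}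
    (P : Finpartition (Finset.univ : Finset ι)) (i : ι → Fin n) : Prop :=
  ∀ a b : ι, sameBlock P a b → i a = i b

/-- The kernel (partition into fibers) of the map `p` equals the set partition `P`. -/
def kernelEq {ι : Type*} [DecidableEq ι] [Fintype ι] {m : ℕ}
    (p : ι → Fin m) (P : Finpartition (Finset.univ : Finset ι)) : Prop :=
  ∀ a b : ι, p a = p b ↔ sameBlock P a b

/-- The linear functional `Φ_P` with `Φ_P (δ_i) = 1` if `i` is constant on every
block of `P`, and `0` otherwise. -/
def PhiP {k n : ℕ} (P : Finpartition (Finset.univ : Finset (Fin k))) :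
    ((Fin k → Fin n) → 𝕜) →ₗ[𝕜] 𝕜 :=
  ∑ i : Fin k → Fin n,
    (if constOnBlocks P i then (1 : 𝕜) else 0) •
      (LinearMap.proj i : ((Fin k → Fin n) → 𝕜) →ₗ[𝕜] 𝕜)

/-- The linear functional `f_P` with `f_P (δ_i) = 1` if the kernel of `i` equals `P`,
and `0` otherwise. -/
def fP {k n : ℕ} (P : Finpartition (Finset.univ : Finset (Fin k))) :
    ((Fin k → Fin n) → 𝕜) →ₗ[𝕜] 𝕜 :=
  ∑ i : Fin k → Fin n,
    (if kernelEq i P then (1 : 𝕜) else 0) •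
      (LinearMap.proj i : ((Fin k → Fin n) → 𝕜) →ₗ[𝕜] 𝕜)

/-- The jellyfish functional `J_{p,r}`: `J_{p,r} (δ_i) = DET (i ∘ r)` if `i` is constant
on every fiber of `p`, and `0` otherwise. -/
def Jf {k n : ℕ} (p : Fin k → Fin n) (r : Fin n → Fin k) :
    ((Fin k → Fin n) → 𝕜) →ₗ[𝕜] 𝕜 :=
  ∑ i : Fin k → Fin n,
    (if ∀ a b : Fin k, p a = p b → i a = i b then DET (i ∘ r) else (0 : 𝕜)) •
      (LinearMap.proj i : ((Fin k → Fin n) → 𝕜) →ₗ[𝕜] 𝕜)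

/-- The `n × n` matrix `M(i)` whose column `c`, for `c : Fin (n-1)` embedded as the first
`n-1` columns, is the standard basis vector `e_{i (r c)}`, and whose last column is the
all-ones vector. -/
def Mmat {k n : ℕ} (r : Fin (n - 1) → Fin k) (i : Fin k → Fin n) :
    Matrix (Fin n) (Fin n) 𝕜 :=
  Matrix.of fun a b =>
    if h : (b : ℕ) < n - 1 then (if i (r ⟨(b : ℕ), h⟩) = a then 1 else 0) else 1

/-- The jellyfish functional `J'_{p,r}` (one dangling leg): `J'_{p,r} (δ_i) = det M(i)`
if `i` is constant on every fiber of `p`, and `0` otherwise. -/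
def Jf' {k n : ℕ} (p : Fin k → Fin (n - 1)) (r : Fin (n - 1) → Fin k) :
    ((Fin k → Fin n) → 𝕜) →ₗ[𝕜] 𝕜 :=
  ∑ i : Fin k → Fin n,
    (if ∀ a b : Fin k, p a = p b → i a = i b then (Mmat r i).det else (0 : 𝕜)) •
      (LinearMap.proj i : ((Fin k → Fin n) → 𝕜) →ₗ[𝕜] 𝕜)

/-- The linear map `T_P : W_k → W_ℓ` with `(T_P δ_i) (i') = 1` if `Sum.elim i i'` is
constant on every block of `P`, and `0` otherwise. -/
def TP {k l n : ℕ} (P : Finpartition (Finset.univ : Finset (Fin k ⊕ Fin l))) :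
    ((Fin k → Fin n) → 𝕜) →ₗ[𝕜] ((Fin l → Fin n) → 𝕜) :=
  ∑ i : Fin k → Fin n, ∑ i' : Fin l → Fin n,
    (if constOnBlocks P (Sum.elim i i') then (1 : 𝕜) else 0) •
      ((LinearMap.single 𝕜 (fun _ : Fin l → Fin n => 𝕜) i').comp
        (LinearMap.proj i : ((Fin k → Fin n) → 𝕜) →ₗ[𝕜] 𝕜))

/-- The subspace of linear functionals on `(ι → Fin n) → 𝕜` invariant under all
permutations in `S`. -/
def invariantDual (𝕜 : Type*) [Field 𝕜] (ι : Type*) {n : ℕ}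
    (S : Set (Equiv.Perm (Fin n))) :
    Submodule 𝕜 (((ι → Fin n) → 𝕜) →ₗ[𝕜] 𝕜) where
  carrier := {φ | ∀ σ ∈ S, ∀ g : (ι → Fin n) → 𝕜, φ (permAct σ g) = φ g}
  add_mem' := by
    intro φ ψ hφ hψ σ hσ g
    simp only [LinearMap.add_apply, hφ σ hσ g, hψ σ hσ g]
  zero_mem' := by intro σ hσ g; simp
  smul_mem' := by
    intro c φ hφ σ hσ g
    simp only [LinearMap.smul_apply, hφ σ hσ g]

/-- The subspace of linear maps `W_k → W_ℓ` commuting with the actions of all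
permutations in `S`. -/
def equivariantMaps (𝕜 : Type*) [Field 𝕜] (k l : ℕ) {n : ℕ}
    (S : Set (Equiv.Perm (Fin n))) :
    Submodule 𝕜 (((Fin k → Fin n) → 𝕜) →ₗ[𝕜] ((Fin l → Fin n) → 𝕜)) where
  carrier := {T | ∀ σ ∈ S, ∀ g : (Fin k → Fin n) → 𝕜, T (permAct σ g) = permAct σ (T g)}
  add_mem' := by
    intro T T' hT hT' σ hσ g
    funext j
    simp [LinearMap.add_apply, hT σ hσ g, hT' σ hσ g, permAct]
  zero_mem' := by intro σ hσ g; funext j; simp [permAct]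
  smul_mem' := by
    intro c T hT σ hσ g
    funext j
    simp [LinearMap.smul_apply, hT σ hσ g, permAct]

end Jellyfish

namespace Jellyfish

variable {𝕜 : Type*} [Field 𝕜] {ι : Type*} [DecidableEq ι] [Fintype ι] {n : ℕ}

/-- The partition of `ι` into the fibers of `i`. -/
def kerPartition {β : Type*} (i : ι → β) : Finpartition (Finset.univ : Finset ι) :=
  Finpartition.ofSetoid (Setoid.ker i)

theorem sameBlock_iff_mem_part (P : Finpartition (Finset.univ : Finset ι)) (a b : ι) :
    sameBlock P a b ↔ b ∈ P.part a := by
  constructor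
  · rintro ⟨B, hB, ha, hb⟩
    rwa [P.part_eq_of_mem hB ha]
  · intro h
    exact ⟨P.part a, P.part_mem.2 (Finset.mem_univ a), P.mem_part (Finset.mem_univ a), h⟩

theorem sameBlock_kerPartition {β : Type*} (i : ι → β) (a b : ι) :
    sameBlock (kerPartition i) a b ↔ i a = i b := by
  rw [sameBlock_iff_mem_part]
  exact Finpartition.mem_part_ofSetoid_iff_rel

theorem le_iff_sameBlock (P Q : Finpartition (Finset.univ : Finset ι)) :
    P ≤ Q ↔ ∀ a b, sameBlock P a b → sameBlock Q a b := by
  constructor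
  · rintro h a b ⟨B, hB, ha, hb⟩
    obtain ⟨C, hC, hBC⟩ := h hB
    exact ⟨C, hC, hBC ha, hBC hb⟩
  · intro h B hB
    obtain ⟨a, ha⟩ := P.nonempty_of_mem_parts hB
    exact ⟨Q.part a, Q.part_mem.2 (Finset.mem_univ a), fun b hb =>
      (sameBlock_iff_mem_part Q a b).1 (h a b ⟨B, hB, ha, hb⟩)⟩

theorem constOnBlocks_iff_le_kerPartition (P : Finpartition (Finset.univ : Finset ι))
    (i : ι → Fin n) : constOnBlocks P i ↔ P ≤ kerPartition i := by
  simp only [constOnBlocks, le_iff_sameBlock, sameBlock_kerPartition]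

theorem injective_of_kerPartition_eq_bot {β : Type*} {i : ι → β} (h : kerPartition i = ⊥) :
    Function.Injective i := by
  intro a b hab
  obtain ⟨B, hB, ha, hb⟩ := h ▸ (sameBlock_kerPartition i a b).2 hab
  obtain ⟨c, -, rfl⟩ := Finpartition.mem_bot_iff.1 hB
  exact (Finset.mem_singleton.1 ha).trans (Finset.mem_singleton.1 hb).symm

theorem exists_kerPartition_eq (h : Fintype.card ι ≤ n)
    (P : Finpartition (Finset.univ : Finset ι)) :
    ∃ i : ι → Fin n, kerPartition i = P := by
  obtain ⟨e⟩ : Nonempty (ι ↪ Fin n) :=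
    Function.Embedding.nonempty_of_card_le (by simpa using h)
  have hne (a : ι) : (P.part a).Nonempty := ⟨a, P.mem_part (Finset.mem_univ a)⟩
  have hrep (a : ι) : P.part (hne a).choose = P.part a :=
    P.part_eq_of_mem (P.part_mem.2 (Finset.mem_univ a)) (hne a).choose_spec
  refine ⟨fun a => e (hne a).choose, ?_⟩
  have key (a b : ι) : sameBlock (kerPartition fun a => e (hne a).choose) a b ↔
      sameBlock P a b := by
    rw [sameBlock_kerPartition, sameBlock_iff_mem_part, e.injective.eq_iff]
    constructor
    · intro hab
      rw [← hrep a, hab, hrep b]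
      exact P.mem_part (Finset.mem_univ b)
    · intro hb
      have hab : P.part b = P.part a :=
        P.part_eq_of_mem (P.part_mem.2 (Finset.mem_univ a)) hb
      simp only [hab]
  exact le_antisymm ((le_iff_sameBlock _ _).2 fun a b => (key a b).1)
    ((le_iff_sameBlock _ _).2 fun a b => (key a b).2)

/-- The indicator functions of tuples constant on the blocks of `P`, as `P` ranges over the
partitions of `ι`, satisfy a nontrivial linear relation exactly when `n < card ι`. -/
theorem forall_sum_constOnBlocks_iff :
    (∀ c : Finpartition (Finset.univ : Finset ι) → 𝕜,
      (∀ i : ι → Fin n, ∑ P, c P * (if constOnBlocks P i then 1 else 0) = 0) → ∀ P, c P = 0) ↔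
      Fintype.card ι ≤ n := by
  simp only [constOnBlocks_iff_le_kerPartition]
  constructor
  · intro hinj
    by_contra! hlt
    let A : (Finpartition (Finset.univ : Finset ι) → 𝕜) →ₗ[𝕜]
        ({P : Finpartition (Finset.univ : Finset ι) // P ≠ ⊥} → 𝕜) :=
      LinearMap.pi fun P => ∑ Q, (if Q ≤ P.1 then (1 : 𝕜) else 0) • LinearMap.proj Q
    have hcard : Module.finrank 𝕜
        ({P : Finpartition (Finset.univ : Finset ι) // P ≠ ⊥} → 𝕜) <
        Module.finrank 𝕜 (Finpartition (Finset.univ : Finset ι) → 𝕜) := by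
      rw [Module.finrank_fintype_fun_eq_card, Module.finrank_fintype_fun_eq_card]
      exact Fintype.card_subtype_lt (x := ⊥) (by simp)
    obtain ⟨c, hc, hc0⟩ := (Submodule.ne_bot_iff _).1 (A.ker_ne_bot_of_finrank_lt hcard)
    refine hc0 (funext (hinj c fun i => ?_))
    have hi : kerPartition i ≠ ⊥ := fun h => by
      have := Fintype.card_le_of_injective i (injective_of_kerPartition_eq_bot h)
      rw [Fintype.card_fin] at this
      omega
    simpa [A, -ite_smul] using congrFun (LinearMap.mem_ker.1 hc) ⟨_, hi⟩
  · intro hle c hc P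
    induction P using WellFoundedLT.induction with
    | ind P ih =>
      obtain ⟨i, rfl⟩ := exists_kerPartition_eq hle P
      have h := hc i
      rw [Finset.sum_eq_single (kerPartition i)] at h
      · simpa using h
      · intro Q _ hQ
        by_cases hle : Q ≤ kerPartition i
        · simp [ih Q (lt_of_le_of_ne hle hQ)]
        · simp [hle]
      · simp

theorem TP_single_apply {k l n : ℕ} (P : Finpartition (Finset.univ : Finset (Fin k ⊕ Fin l)))
    (i : Fin k → Fin n) (i' : Fin l → Fin n) :
    (TP P : ((Fin k → Fin n) → 𝕜) →ₗ[𝕜] ((Fin l → Fin n) → 𝕜)) (Pi.single i 1) i' =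
      if constOnBlocks P (Sum.elim i i') then 1 else 0 := by
  simp only [TP, LinearMap.sum_apply, Finset.sum_apply, LinearMap.smul_apply, Pi.smul_apply,
    LinearMap.comp_apply, LinearMap.proj_apply, LinearMap.single_apply]
  rw [Finset.sum_eq_single i, Finset.sum_eq_single i']
  · simp
  · intro j _ hj
    simp [Pi.single_eq_of_ne' hj]
  · simp
  · intro j _ hj
    simp [Pi.single_eq_of_ne hj]
  · simp

theorem sum_smul_TP_eq_zero_iff {k l n : ℕ}
    (c : Finpartition (Finset.univ : Finset (Fin k ⊕ Fin l)) → 𝕜) :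
    ∑ P, c P • (TP P : ((Fin k → Fin n) → 𝕜) →ₗ[𝕜] ((Fin l → Fin n) → 𝕜)) = 0 ↔
      ∀ i : Fin k ⊕ Fin l → Fin n, ∑ P, c P * (if constOnBlocks P i then 1 else 0) = 0 := by
  constructor
  · intro h i
    have := congrFun (LinearMap.congr_fun h (Pi.single (i ∘ Sum.inl) 1)) (i ∘ Sum.inr)
    simpa [LinearMap.sum_apply, Finset.sum_apply, TP_single_apply, Sum.elim_comp_inl_inr]
      using this
  · intro h
    refine LinearMap.pi_ext' fun i => LinearMap.ext_ring (funext fun i' => ?_)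
    simpa [LinearMap.sum_apply, Finset.sum_apply, TP_single_apply] using h (Sum.elim i i')

end Jellyfish

open Jellyfish

/-- the family `(T_P)`, indexed by all set partitions of `Fin k ⊕ Fin ℓ`,
is linearly independent iff `k + ℓ ≤ n`. -/
theorem statement3 (𝕜 : Type*) [Field 𝕜] (hchar : ringChar 𝕜 ≠ 2)
    (n k l : ℕ) (hn : 0 < n) :
    LinearIndependent 𝕜
      (fun P : Finpartition (Finset.univ : Finset (Fin k ⊕ Fin l)) =>
        (TP P : ((Fin k → Fin n) → 𝕜) →ₗ[𝕜] ((Fin l → Fin n) → 𝕜))) ↔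
      k + l ≤ n := by
  rw [Fintype.linearIndependent_iff]
  simp only [sum_smul_TP_eq_zero_iff]
  simpa using forall_sum_constOnBlocks_iff (𝕜 := 𝕜) (ι := Fin k ⊕ Fin l) (n := n)
end
end

section
/- Let p : Fin k → Fin n be a surjection and r : Fin n → Fin k a section of p (p ∘ r = id). Then the functional J_{p,r} satisfies: (1) J_{p,r}(δ_{σ ∘ i}) = sign(σ) · J_{p,r}(δ_i) for every σ ∈ Perm (Fin n) and every tuple i : Fin k → Fin n; and (2) if the kernel of i equals the kernel of p (∀ a b, i a = i b ↔ p a = p b) then J_{p,r}(δ_i) = 1 or J_{p,r}(δ_i) = −1, while otherwise J_{p,r}(δ_i) = 0. (This is the proposition on the jellyfish functionals Ψ(j_D) for partition diagrams D with exactly n parts.) -/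
open scoped Classical

noncomputable section

open Jellyfish

namespace Jellyfish

variable {𝕜 : Type*} [Field 𝕜]

theorem Jf_delta {k n : ℕ} (p : Fin k → Fin n) (r : Fin n → Fin k) (i : Fin k → Fin n) :
    Jf p r (delta i) =
      if ∀ a b : Fin k, p a = p b → i a = i b then DET (i ∘ r) else (0 : 𝕜) := by
  unfold Jf delta
  simp only [LinearMap.sum_apply, LinearMap.smul_apply, LinearMap.proj_apply, smul_eq_mul,
    mul_ite, mul_one, mul_zero, Finset.sum_ite_eq', Finset.mem_univ, if_true]

theorem DET_perm_comp {n : ℕ} (σ : Equiv.Perm (Fin n)) (i : Fin n → Fin n) :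
    DET (σ ∘ i) = ((Equiv.Perm.sign σ : ℤ) : 𝕜) * DET i := by
  have h := Matrix.det_permute σ.symm (Matrix.of fun a b => if i b = a then (1 : 𝕜) else 0)
  rw [Equiv.Perm.sign_symm] at h
  unfold DET
  rw [← h]
  congr 1
  ext a b
  simp [Equiv.eq_symm_apply]

theorem DET_id {n : ℕ} : DET (id : Fin n → Fin n) = (1 : 𝕜) := by
  have h : (Matrix.of fun a b : Fin n => if id b = a then (1 : 𝕜) else 0) = 1 := by
    ext a b
    simp [Matrix.one_apply, eq_comm]
  rw [DET, h, Matrix.det_one]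

theorem DET_perm {n : ℕ} (σ : Equiv.Perm (Fin n)) :
    DET σ = ((Equiv.Perm.sign σ : ℤ) : 𝕜) := by
  simpa [DET_id] using DET_perm_comp (𝕜 := 𝕜) σ id

theorem DET_eq_zero_of_not_injective {n : ℕ} {i : Fin n → Fin n}
    (hi : ¬ Function.Injective i) : DET i = (0 : 𝕜) := by
  obtain ⟨b, c, hbc, hne⟩ := Function.not_injective_iff.mp hi
  exact Matrix.det_zero_of_column_eq hne fun a => by simp [hbc]

theorem DET_eq_one_or_neg_one_of_injective {n : ℕ} {i : Fin n → Fin n}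
    (hi : Function.Injective i) : DET i = (1 : 𝕜) ∨ DET i = (-1 : 𝕜) := by
  have h := DET_perm (𝕜 := 𝕜) (Equiv.ofBijective i (Finite.injective_iff_bijective.mp hi))
  rw [Equiv.coe_ofBijective] at h
  rw [h]
  rcases Int.units_eq_one_or
    (Equiv.Perm.sign (Equiv.ofBijective i (Finite.injective_iff_bijective.mp hi))) with hs | hs <;>
    simp [hs]

end Jellyfish

/-- properties of the jellyfish functional `J_{p,r}` for a surjection
`p : Fin k → Fin n` with section `r`. -/
theorem statement12 (𝕜 : Type*) [Field 𝕜] (hchar : ringChar 𝕜 ≠ 2)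
    (n k : ℕ) (hn : 0 < n) (p : Fin k → Fin n) (r : Fin n → Fin k)
    (hp : Function.Surjective p) (hpr : p ∘ r = id) :
    (∀ (σ : Equiv.Perm (Fin n)) (i : Fin k → Fin n),
      Jf p r (delta (⇑σ ∘ i)) = ((Equiv.Perm.sign σ : ℤ) : 𝕜) * Jf p r (delta i)) ∧
    (∀ i : Fin k → Fin n,
      ((∀ a b : Fin k, i a = i b ↔ p a = p b) →
        (Jf p r (delta i) = (1 : 𝕜) ∨ Jf p r (delta i) = (-1 : 𝕜))) ∧
      (¬ (∀ a b : Fin k, i a = i b ↔ p a = p b) → Jf p r (delta i) = (0 : 𝕜))) := by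
  have hr : ∀ c, p (r c) = c := congrFun hpr
  refine ⟨fun σ i => ?_, fun i => ⟨fun h => ?_, fun h => ?_⟩⟩
  · simp only [Jf_delta, Function.comp_apply, EmbeddingLike.apply_eq_iff_eq, mul_ite, mul_zero,
      Function.comp_assoc, DET_perm_comp]
  · rw [Jf_delta, if_pos fun a b => (h a b).mpr]
    refine DET_eq_one_or_neg_one_of_injective fun c d hcd => ?_
    simpa [hr] using (h (r c) (r d)).mp hcd
  · rw [Jf_delta]
    split_ifs with hc
    · refine DET_eq_zero_of_not_injective fun hinj => h fun a b => ⟨fun hab => ?_, hc a b⟩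
      apply hinj
      simp only [Function.comp_apply]
      rw [hc _ a (hr _), hc _ b (hr _), hab]
    · rfl
end
end
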